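/- arXiv:1612.06003 — 3 statements merged into one kernel-verified Lean document; each statement's English description precedes it below -/
import Mathlib

section
/- Let h : ℝ^N → ℝ be arbitrary (possibly non-convex), let g : ℝ^N → ℝ be differentiable with L-Lipschitz continuous gradient, let 0 < γ < 1/L, and let x* be a global minimizer of f = g + h. Let x_0 ∈ ℝ^N and let the IPG iterates satisfy x_k ∈ Prox^{ε_k}_{γh}(x_{k−1} − γ∇g(x_{k−1})) with errors ε_k ≥ 0 for k = 1, …, m. Then (1/m)·Σ_{k=1}^m ‖x_k − x_{k−1}‖² ≤ ( 1 / ( m·(1/(2γ) − L/2) ) )·( f(x_0) − f(x*) + Σ_{k=1}^m ε_k ). -/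
open scoped RealInnerProductSpace
open Filter Topology

noncomputable section

abbrev E (N : ℕ) := EuclideanSpace ℝ (Fin N)

/-- `z` is an `ε`-inexact proximal point of `h` with stepsize `γ` at `y`:
`(1/(2γ))‖z − y‖² + h(z) ≤ ε + (1/(2γ))‖x − y‖² + h(x)` for all `x`. -/
def IsInexactProx {N : ℕ} (γ : ℝ) (h : E N → ℝ) (ε : ℝ) (y z : E N) : Prop :=
  ∀ x : E N, 1 / (2 * γ) * ‖z - y‖ ^ 2 + h z ≤ ε + 1 / (2 * γ) * ‖x - y‖ ^ 2 + h x

/-- The `ε`-approximate subdifferential of `h` at `x`. -/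
def epsSubdiff {N : ℕ} (h : E N → ℝ) (ε : ℝ) (x : E N) : Set (E N) :=
  {d : E N | ∀ y : E N, h y ≥ h x + ⟪d, y - x⟫ - ε}


/-- Descent lemma: quadratic upper bound for a function with `L`-Lipschitz gradient. -/
theorem le_quadratic_of_lipschitz_gradient {F : Type*} [NormedAddCommGroup F]
    [InnerProductSpace ℝ F] [CompleteSpace F] {g : F → ℝ} {g' : F → F} {L : ℝ}
    (hg : ∀ x, HasGradientAt g (g' x) x)
    (hlip : ∀ x y, ‖g' x - g' y‖ ≤ L * ‖x - y‖) (x y : F) :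
    g y ≤ g x + ⟪g' x, y - x⟫ + L / 2 * ‖y - x‖ ^ 2 := by
  set d := y - x with hd
  have hline (t : ℝ) : HasDerivAt (fun t : ℝ => g (x + t • d)) ⟪g' (x + t • d), d⟫ t := by
    have hl : HasDerivAt (fun t : ℝ => x + t • d) d t := by
      simpa using ((hasDerivAt_id t).smul_const d).const_add x
    exact (hg (x + t • d)).hasFDerivAt.comp_hasDerivAt t hl
  have hquad (t : ℝ) : HasDerivAt
      (fun t : ℝ => g x + t * ⟪g' x, d⟫ + L / 2 * ‖d‖ ^ 2 * t ^ 2)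
      (⟪g' x, d⟫ + L * t * ‖d‖ ^ 2) t := by
    have := (((hasDerivAt_id t).mul_const ⟪g' x, d⟫).const_add (g x)).add
      ((hasDerivAt_pow 2 t).const_mul (L / 2 * ‖d‖ ^ 2))
    refine this.congr_deriv ?_
    push_cast
    ring
  have key := image_le_of_deriv_right_le_deriv_boundary (a := 0) (b := 1)
    (fun t _ => (hline t).continuousAt.continuousWithinAt)
    (fun t _ => (hline t).hasDerivWithinAt) (by simp)
    (fun t _ => (hquad t).continuousAt.continuousWithinAt)
    (fun t _ => (hquad t).hasDerivWithinAt)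
    (fun t ht => by
      have hdiff : ⟪g' (x + t • d), d⟫ - ⟪g' x, d⟫ ≤ L * t * ‖d‖ ^ 2 := calc
        _ = ⟪g' (x + t • d) - g' x, d⟫ := (inner_sub_left _ _ _).symm
        _ ≤ ‖g' (x + t • d) - g' x‖ * ‖d‖ := real_inner_le_norm _ _
        _ ≤ L * ‖x + t • d - x‖ * ‖d‖ := by gcongr; exact hlip _ _
        _ = L * t * ‖d‖ ^ 2 := by
          rw [add_sub_cancel_left, norm_smul, Real.norm_of_nonneg ht.1]; ring
      linarith) (Set.right_mem_Icc.2 zero_le_one)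
  simpa [hd] using key

/-- Sufficient decrease of one inexact proximal gradient step. -/
theorem IsInexactProx.sufficient_decrease {N : ℕ} {g h : E N → ℝ} {g' : E N → E N}
    {L γ ε : ℝ} {x z : E N}
    (hg : ∀ x, HasGradientAt g (g' x) x)
    (hlip : ∀ x y, ‖g' x - g' y‖ ≤ L * ‖x - y‖) (hγ : γ ≠ 0)
    (hz : IsInexactProx γ h ε (x - γ • g' x) z) :
    (1 / (2 * γ) - L / 2) * ‖z - x‖ ^ 2 ≤ g x + h x - (g z + h z) + ε := by
  have hdesc := le_quadratic_of_lipschitz_gradient hg hlip x z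
  have hprox := hz x
  rw [show z - (x - γ • g' x) = (z - x) + γ • g' x by abel, sub_sub_cancel,
    norm_add_sq_real, inner_smul_right, real_inner_comm] at hprox
  have hexp : 1 / (2 * γ) * (‖z - x‖ ^ 2 + 2 * (γ * ⟪g' x, z - x⟫) + ‖γ • g' x‖ ^ 2) =
      1 / (2 * γ) * ‖z - x‖ ^ 2 + ⟪g' x, z - x⟫ + 1 / (2 * γ) * ‖γ • g' x‖ ^ 2 := by
    field_simp
  linarith

/-- convergence rate of IPG when `h` is possibly non-convex. -/
theorem ipg_rate_nonconvex_h {N : ℕ} (g h : E N → ℝ) (g' : E N → E N) (L γ : ℝ)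
    (hL : 0 < L)
    (hg : ∀ x, HasGradientAt g (g' x) x)
    (hlip : ∀ x y, ‖g' x - g' y‖ ≤ L * ‖x - y‖)
    (hγ0 : 0 < γ) (hγL : γ < 1 / L)
    (xstar : E N) (hmin : ∀ y, g xstar + h xstar ≤ g y + h y)
    (m : ℕ) (hm : 1 ≤ m) (x : ℕ → E N) (ε : ℕ → ℝ)
    (hε : ∀ k ∈ Finset.Icc 1 m, 0 ≤ ε k)
    (hstep : ∀ k ∈ Finset.Icc 1 m,
      IsInexactProx γ h (ε k) (x (k - 1) - γ • g' (x (k - 1))) (x k)) :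
    (1 / (m : ℝ)) * ∑ k ∈ Finset.Icc 1 m, ‖x k - x (k - 1)‖ ^ 2 ≤
      1 / ((m : ℝ) * (1 / (2 * γ) - L / 2)) *
        (g (x 0) + h (x 0) - (g xstar + h xstar) + ∑ k ∈ Finset.Icc 1 m, ε k) := by
  have hc : 0 < 1 / (2 * γ) - L / 2 := by
    rw [lt_div_iff₀ hL] at hγL
    rw [sub_pos, lt_div_iff₀ (by positivity)]
    linarith
  have hm0 : (0 : ℝ) < m := by exact_mod_cast hm
  have htele : ∀ n ≤ m, (1 / (2 * γ) - L / 2) * ∑ k ∈ Finset.Icc 1 n, ‖x k - x (k - 1)‖ ^ 2 ≤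
      g (x 0) + h (x 0) - (g (x n) + h (x n)) + ∑ k ∈ Finset.Icc 1 n, ε k := by
    intro n hn
    induction n with
    | zero => simp
    | succ n ih =>
      rw [Finset.sum_Icc_succ_top (by omega), Finset.sum_Icc_succ_top (by omega), mul_add]
      have hdec := (hstep (n + 1) (Finset.mem_Icc.2 ⟨by omega, hn⟩)).sufficient_decrease
        hg hlip hγ0.ne'
      rw [Nat.add_sub_cancel] at hdec ⊢
      linarith [ih (by omega)]
  have hsum := htele m le_rfl
  have hopt := hmin (x m)
  rw [one_div_mul_eq_div, one_div_mul_eq_div, div_le_div_iff₀ hm0 (by positivity)]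
  nlinarith
end
end

section
/- (Approximate stationarity at an inexact proximal point.) Let h : ℝ^N → ℝ be convex, let g : ℝ^N → ℝ be differentiable with L-Lipschitz continuous gradient, let γ > 0, let ε ≥ 0, and let x, v ∈ ℝ^N with v ∈ Prox^ε_{γh}(x − γ∇g(x)). Then there exists d ∈ ∂_ε h(v) such that ‖∇g(v) + d‖ ≤ (1/γ + L)·‖x − v‖ + √(2ε/γ); in particular, dist(0, ∇g(v) + ∂_ε h(v)) ≤ (1/γ + L)·‖x − v‖ + √(2ε/γ). -/
open scoped RealInnerProductSpace
open Filter Topology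

noncomputable section

/-- A concave function lying below a continuous convex function is separated from it by a
continuous affine function. -/
theorem ConvexOn.exists_affine_between {F : Type*} [NormedAddCommGroup F] [NormedSpace ℝ F]
    {f k : F → ℝ} (hf : ConvexOn ℝ Set.univ f) (hfc : Continuous f)
    (hk : ConcaveOn ℝ Set.univ k) (hkf : ∀ x, k x ≤ f x) :
    ∃ (l : StrongDual ℝ F) (c : ℝ), ∀ x, k x ≤ l x + c ∧ l x + c ≤ f x := by
  have hopen : IsOpen {p : F × ℝ | p.1 ∈ Set.univ ∧ f p.1 < p.2} := by
    simpa using isOpen_lt (hfc.comp continuous_fst) continuous_snd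
  have hdisj : Disjoint {p : F × ℝ | p.1 ∈ Set.univ ∧ f p.1 < p.2}
      {p : F × ℝ | p.1 ∈ Set.univ ∧ p.2 ≤ k p.1} :=
    Set.disjoint_left.2 fun p hp hq => (hp.2.trans_le hq.2).not_ge (hkf p.1)
  obtain ⟨φ, u, hlt, hle⟩ := geometric_hahn_banach_open hf.convex_strict_epigraph hopen
    hk.convex_hypograph hdisj
  set b := φ (0, 1) with hb
  have hφ (x : F) (t : ℝ) : φ (x, t) = φ (x, 0) + t * b := by
    rw [hb, ← smul_eq_mul, ← map_smul, ← map_add]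
    simp
  have habove (x : F) (t : ℝ) (ht : f x < t) : φ (x, 0) + t * b < u :=
    hφ x t ▸ hlt (x, t) ⟨trivial, ht⟩
  have hbelow (x : F) : u ≤ φ (x, 0) + k x * b := hφ x (k x) ▸ hle (x, k x) ⟨trivial, le_rfl⟩
  have hb0 : b < 0 := by
    nlinarith [habove 0 (f 0 + 1) (lt_add_one _), hbelow 0, hkf 0]
  have hcl (x : F) : φ (x, 0) + f x * b ≤ u := by
    have hlim : Tendsto (fun t => φ (x, 0) + t * b) (𝓝[>] f x) (𝓝 (φ (x, 0) + f x * b)) :=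
      (by fun_prop : Continuous fun t : ℝ => φ (x, 0) + t * b).continuousWithinAt
    exact le_of_tendsto hlim (eventually_mem_nhdsWithin.mono fun t ht => (habove x t ht).le)
  refine ⟨-b⁻¹ • φ.comp (.inl ℝ F ℝ), u / b, fun x => ?_⟩
  have hval : (-b⁻¹ • φ.comp (.inl ℝ F ℝ)) x + u / b = (u - φ (x, 0)) / b := by
    simp
    ring
  rw [hval]
  exact ⟨(le_div_iff_of_neg hb0).2 (by linarith [hbelow x]),
    (div_le_iff_of_neg hb0).2 (by linarith [hcl x])⟩

/-- An affine function with slope `r` that stays above `-ε` after adding `‖·‖² / (2γ)` has slope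
at most `√(2ε/γ)`. -/
theorem norm_le_sqrt_of_neg_le_inner_add_sq {F : Type*} [NormedAddCommGroup F]
    [InnerProductSpace ℝ F] {γ ε : ℝ} (hγ : 0 < γ) {r : F}
    (hr : ∀ w : F, -ε ≤ ⟪r, w⟫ + 1 / (2 * γ) * ‖w‖ ^ 2) :
    ‖r‖ ≤ Real.sqrt (2 * ε / γ) := by
  refine Real.le_sqrt_of_sq_le ?_
  have h := hr (-γ • r)
  rw [inner_smul_right, real_inner_self_eq_norm_sq, norm_smul, mul_pow, Real.norm_eq_abs, sq_abs]
    at h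
  have hquad : -γ * ‖r‖ ^ 2 + 1 / (2 * γ) * ((-γ) ^ 2 * ‖r‖ ^ 2) = -(γ * ‖r‖ ^ 2 / 2) := by
    field_simp
    ring
  rw [hquad] at h
  rw [le_div_iff₀ hγ]
  linarith

/-- At an inexact proximal point `v` of a convex function, the residual `(y - v) / γ` is within
`√(2ε/γ)` of an `ε`-subgradient. -/
theorem IsInexactProx.exists_mem_epsSubdiff {N : ℕ} {h : E N → ℝ} {γ ε : ℝ} {y v : E N}
    (hv : IsInexactProx γ h ε y v) (hconv : ConvexOn ℝ Set.univ h) (hγ : 0 < γ) :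
    ∃ d ∈ epsSubdiff h ε v, ‖d + γ⁻¹ • (v - y)‖ ≤ Real.sqrt (2 * ε / γ) := by
  have hsq : ConvexOn ℝ Set.univ fun u : E N => 1 / (2 * γ) * ‖u - y‖ ^ 2 := by
    have hdist := (convexOn_dist y (convex_univ (𝕜 := ℝ))).pow (fun _ _ => dist_nonneg) 2
    simpa [dist_eq_norm] using hdist.smul (c := 1 / (2 * γ)) (by positivity)
  obtain ⟨l, c, hl⟩ := hconv.exists_affine_between hconv.locallyLipschitz.continuous
    (hsq.neg.add_const (h v - ε + 1 / (2 * γ) * ‖v - y‖ ^ 2))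
    (fun u => by simp only [Pi.add_apply, Pi.neg_apply]; linarith [hv u])
  simp only [Pi.add_apply, Pi.neg_apply] at hl
  have hd (u : E N) : ⟪(InnerProductSpace.toDual ℝ (E N)).symm l, u⟫ = l u :=
    InnerProductSpace.toDual_symm_apply
  refine ⟨(InnerProductSpace.toDual ℝ (E N)).symm l, fun u => ?_, ?_⟩
  · rw [hd, map_sub]
    linarith [(hl u).2, (hl v).1]
  · refine norm_le_sqrt_of_neg_le_inner_add_sq hγ fun w => ?_
    have hw := (hl (v + w)).1
    have hexp : 1 / (2 * γ) * ‖v + w - y‖ ^ 2 =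
        1 / (2 * γ) * ‖v - y‖ ^ 2 + γ⁻¹ * ⟪v - y, w⟫ + 1 / (2 * γ) * ‖w‖ ^ 2 := by
      rw [add_sub_right_comm, norm_add_sq_real]
      field_simp
    rw [hexp, map_add] at hw
    rw [inner_add_left, hd, real_inner_smul_left]
    linarith [(hl v).2]

/-- approximate stationarity at an inexact proximal point. -/
theorem approx_stationarity_inexact_prox {N : ℕ} (g h : E N → ℝ) (g' : E N → E N)
    (L γ ε : ℝ) (hL : 0 < L)
    (hg : ∀ x, HasGradientAt g (g' x) x)
    (hlip : ∀ x y, ‖g' x - g' y‖ ≤ L * ‖x - y‖)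
    (hconv : ConvexOn ℝ Set.univ h)
    (hγ0 : 0 < γ) (hε : 0 ≤ ε)
    (x v : E N)
    (hstep : IsInexactProx γ h ε (x - γ • g' x) v) :
    (∃ d ∈ epsSubdiff h ε v,
      ‖g' v + d‖ ≤ (1 / γ + L) * ‖x - v‖ + Real.sqrt (2 * ε / γ)) ∧
    sInf ((fun d => ‖g' v + d‖) '' epsSubdiff h ε v) ≤
      (1 / γ + L) * ‖x - v‖ + Real.sqrt (2 * ε / γ) := by
  have hex : ∃ d ∈ epsSubdiff h ε v,
      ‖g' v + d‖ ≤ (1 / γ + L) * ‖x - v‖ + Real.sqrt (2 * ε / γ) := by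
    obtain ⟨d, hd, hnorm⟩ := hstep.exists_mem_epsSubdiff hconv hγ0
    refine ⟨d, hd, ?_⟩
    have hdecomp : g' v + d = γ⁻¹ • (x - v) + (g' v - g' x) +
        (d + γ⁻¹ • (v - (x - γ • g' x))) := by
      have hcancel : γ⁻¹ • γ • g' x = g' x := inv_smul_smul₀ hγ0.ne' _
      simp only [smul_sub, hcancel]
      abel
    have hsmul : ‖γ⁻¹ • (x - v)‖ = 1 / γ * ‖x - v‖ := by
      rw [norm_smul, Real.norm_of_nonneg (inv_nonneg.2 hγ0.le), one_div]
    have hgrad := norm_sub_rev x v ▸ hlip v x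
    rw [hdecomp]
    refine (norm_add₃_le).trans ?_
    linarith
  refine ⟨hex, ?_⟩
  obtain ⟨d, hd, hnorm⟩ := hex
  exact (csInf_le ⟨0, Set.forall_mem_image.2 fun _ _ => norm_nonneg _⟩
    (Set.mem_image_of_mem _ hd)).trans hnorm
end
end

section
/- (One-step inequality for the inexact proximal step in the convex case.) Let g : ℝ^N → ℝ be convex and differentiable with L-Lipschitz continuous gradient, let h : ℝ^N → ℝ be convex, let f = g + h, let 0 < γ ≤ 1/L, let ε ≥ 0, let y ∈ ℝ^N, and let z ∈ Prox^ε_{γh}(y − γ∇g(y)). Then for every x ∈ ℝ^N: f(z) ≤ f(x) − (1/(2γ))·‖z − y‖² − (1/γ)·⟨z − y, y − x⟩ + √(2ε/γ)·‖x − z‖ + ε. -/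
open scoped RealInnerProductSpace
open Filter Topology

noncomputable section

/-- Descent lemma: the quadratic upper bound for a function with `L`-Lipschitz gradient. -/
theorem le_add_inner_add_sq_of_lipschitz_gradient {F : Type*} [NormedAddCommGroup F]
    [InnerProductSpace ℝ F] [CompleteSpace F] {g : F → ℝ} {g' : F → F} {L : ℝ}
    (hg : ∀ x, HasGradientAt g (g' x) x) (hlip : ∀ x y, ‖g' x - g' y‖ ≤ L * ‖x - y‖) (y z : F) :
    g z ≤ g y + ⟪g' y, z - y⟫ + L / 2 * ‖z - y‖ ^ 2 := by
  set v := z - y with hv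
  have hline (t : ℝ) : HasDerivAt (fun t : ℝ ↦ y + t • v) v t := by
    simpa using ((hasDerivAt_id t).smul_const v).const_add y
  have hderiv (t : ℝ) : HasDerivAt
      (fun t : ℝ ↦ g (y + t • v) - t * ⟪g' y, v⟫ - t ^ 2 * (L / 2 * ‖v‖ ^ 2))
      (⟪g' (y + t • v), v⟫ - ⟪g' y, v⟫ - 2 * t * (L / 2 * ‖v‖ ^ 2)) t := by
    have h₁ := (hg (y + t • v)).hasFDerivAt.comp_hasDerivAt t (hline t)
    have h₂ := (hasDerivAt_id t).mul_const ⟪g' y, v⟫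
    have h₃ := (hasDerivAt_pow 2 t).mul_const (L / 2 * ‖v‖ ^ 2)
    refine ((h₁.sub h₂).sub h₃).congr_deriv ?_
    simp
  have hanti : AntitoneOn
      (fun t : ℝ ↦ g (y + t • v) - t * ⟪g' y, v⟫ - t ^ 2 * (L / 2 * ‖v‖ ^ 2)) (Set.Ici 0) := by
    refine antitoneOn_of_deriv_nonpos (convex_Ici 0)
      (fun t _ ↦ (hderiv t).continuousAt.continuousWithinAt)
      (fun t _ ↦ (hderiv t).differentiableAt.differentiableWithinAt) fun t ht ↦ ?_
    rw [interior_Ici, Set.mem_Ioi] at ht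
    rw [(hderiv t).deriv, ← inner_sub_left]
    have hnorm : ‖g' (y + t • v) - g' y‖ ≤ L * (t * ‖v‖) := by
      simpa [norm_smul, abs_of_pos ht] using hlip (y + t • v) y
    have hinner := (real_inner_le_norm (g' (y + t • v) - g' y) v).trans
      (mul_le_mul_of_nonneg_right hnorm (norm_nonneg v))
    linarith
  have h₀₁ := hanti (Set.mem_Ici.2 le_rfl) (Set.mem_Ici.2 zero_le_one) zero_le_one
  simp [hv] at h₀₁
  linarith

/-- First-order lower bound for a convex function with a gradient at `y`. -/
theorem ConvexOn.add_inner_le_of_hasGradientAt {F : Type*} [NormedAddCommGroup F]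
    [InnerProductSpace ℝ F] [CompleteSpace F] {g : F → ℝ} {d y : F}
    (hconv : ConvexOn ℝ Set.univ g) (hg : HasGradientAt g d y) (x : F) :
    g y + ⟪d, x - y⟫ ≤ g x := by
  have hline : HasDerivAt (AffineMap.lineMap y x : ℝ → F) (x - y) 0 :=
    AffineMap.hasDerivAt_lineMap
  have hderiv : HasDerivAt (g ∘ (AffineMap.lineMap y x : ℝ → F)) ⟪d, x - y⟫ 0 := by
    have hg₀ : HasFDerivAt g (InnerProductSpace.toDual ℝ F d)
        ((AffineMap.lineMap y x : ℝ → F) 0) := by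
      simpa using hg.hasFDerivAt
    simpa using hg₀.comp_hasDerivAt 0 hline
  have hslope := (hconv.comp_affineMap (AffineMap.lineMap y x)).le_slope_of_hasDerivAt
    (Set.mem_univ (0 : ℝ)) (Set.mem_univ 1) zero_lt_one hderiv
  simp [slope_def_field] at hslope
  linarith

/-- Along the segment from `z` to `x`, an inexact proximal point `z` of a convex function satisfies
a perturbed first-order optimality condition. -/
theorem IsInexactProx.mul_sub_le {N : ℕ} {γ ε : ℝ} {h : E N → ℝ} {w z : E N}
    (hz : IsInexactProx γ h ε w z) (hconv : ConvexOn ℝ Set.univ h) (x : E N)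
    {t : ℝ} (ht₀ : 0 ≤ t) (ht₁ : t ≤ 1) :
    t * (h z - h x) ≤ ε + t * (1 / γ * ⟪x - z, z - w⟫) + t ^ 2 * (1 / (2 * γ) * ‖x - z‖ ^ 2) := by
  have hprox := hz ((1 - t) • z + t • x)
  have hseg := hconv.2 (Set.mem_univ z) (Set.mem_univ x) (sub_nonneg.2 ht₁) ht₀ (by ring)
  have hnorm : ‖(1 - t) • z + t • x - w‖ ^ 2 =
      ‖z - w‖ ^ 2 + 2 * (t * ⟪x - z, z - w⟫) + t ^ 2 * ‖x - z‖ ^ 2 := by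
    rw [show (1 - t) • z + t • x - w = (z - w) + t • (x - z) by module, norm_add_sq_real,
      real_inner_smul_right, real_inner_comm, norm_smul, mul_pow, Real.norm_eq_abs, sq_abs]
  rw [hnorm] at hprox
  simp only [smul_eq_mul] at hseg
  have hsplit : 1 / (2 * γ) *
      (‖z - w‖ ^ 2 + 2 * (t * ⟪x - z, z - w⟫) + t ^ 2 * ‖x - z‖ ^ 2) =
      1 / (2 * γ) * ‖z - w‖ ^ 2 + t * (1 / γ * ⟪x - z, z - w⟫) +
        t ^ 2 * (1 / (2 * γ) * ‖x - z‖ ^ 2) := by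
    ring
  linarith

/-- An inexact proximal point of a convex function satisfies an approximate subgradient
inequality. -/
theorem IsInexactProx.le_add_inner {N : ℕ} {γ ε : ℝ} {h : E N → ℝ} {w z : E N}
    (hz : IsInexactProx γ h ε w z) (hconv : ConvexOn ℝ Set.univ h) (hγ : 0 < γ) (hε : 0 ≤ ε)
    (x : E N) :
    h z ≤ h x + 1 / γ * ⟪x - z, z - w⟫ + √(2 * ε / γ) * ‖x - z‖ + ε := by
  set D := ‖x - z‖ with hD
  have hDnn : 0 ≤ D := norm_nonneg _
  -- The step `γ * s / (γ * s + D)` balances the two error terms; `s` then decreases to its limit value.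
  have hbound : ∀ s : ℝ, √(2 * ε / γ) < s →
      h z ≤ h x + 1 / γ * ⟪x - z, z - w⟫ + s * D + γ * s ^ 2 / 2 := by
    intro s hs
    have hs₀ : 0 < s := (Real.sqrt_nonneg _).trans_lt hs
    have hεs : ε ≤ γ * s ^ 2 / 2 := by
      have := (Real.sqrt_lt' hs₀).1 hs
      rw [div_lt_iff₀ hγ] at this
      linarith
    have hσ : 0 < γ * s + D := by positivity
    have ht₀ : 0 < γ * s / (γ * s + D) := by positivity
    have ht₁ : γ * s / (γ * s + D) ≤ 1 := (div_le_one hσ).2 (by linarith)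
    have hseg := hz.mul_sub_le hconv x ht₀.le ht₁
    rw [← hD] at hseg
    set t := γ * s / (γ * s + D) with ht
    have hεt : γ * s ^ 2 / 2 = t * (γ * s ^ 2 / 2 + s * D / 2) := by
      rw [ht]; field_simp
    have htD : t * (1 / (2 * γ) * D ^ 2) ≤ s * D / 2 := by
      have : s * D / 2 - t * (1 / (2 * γ) * D ^ 2) = γ * s ^ 2 * D / (2 * (γ * s + D)) := by
        rw [ht]; field_simp; ring
      have : 0 ≤ γ * s ^ 2 * D / (2 * (γ * s + D)) := by positivity
      linarith
    have := mul_le_mul_of_nonneg_left htD ht₀.le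
    refine le_of_mul_le_mul_left ?_ ht₀
    linarith
  have hlim : Tendsto (fun s : ℝ ↦ h x + 1 / γ * ⟪x - z, z - w⟫ + s * D + γ * s ^ 2 / 2)
      (𝓝[>] √(2 * ε / γ)) (𝓝 (h x + 1 / γ * ⟪x - z, z - w⟫ + √(2 * ε / γ) * D +
        γ * √(2 * ε / γ) ^ 2 / 2)) :=
    (Continuous.tendsto (by fun_prop) _).mono_left nhdsWithin_le_nhds
  have hle := ge_of_tendsto hlim (eventually_nhdsWithin_of_forall hbound)
  have hsq : γ * √(2 * ε / γ) ^ 2 / 2 = ε := by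
    rw [Real.sq_sqrt (by positivity)]; field_simp
  rwa [hsq] at hle

/-- one-step inequality for the inexact proximal step in the convex case. -/
theorem inexact_prox_one_step_convex {N : ℕ} (g h : E N → ℝ) (g' : E N → E N)
    (L γ ε : ℝ) (hL : 0 < L)
    (hg : ∀ x, HasGradientAt g (g' x) x)
    (hlip : ∀ x y, ‖g' x - g' y‖ ≤ L * ‖x - y‖)
    (hgconv : ConvexOn ℝ Set.univ g)
    (hconv : ConvexOn ℝ Set.univ h)
    (hγ0 : 0 < γ) (hγL : γ ≤ 1 / L) (hε : 0 ≤ ε)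
    (y z : E N)
    (hstep : IsInexactProx γ h ε (y - γ • g' y) z) :
    ∀ x : E N,
      g z + h z ≤ g x + h x - 1 / (2 * γ) * ‖z - y‖ ^ 2 -
        (1 / γ) * ⟪z - y, y - x⟫ + Real.sqrt (2 * ε / γ) * ‖x - z‖ + ε := by
  intro x
  have hdesc := le_add_inner_add_sq_of_lipschitz_gradient hg hlip y z
  have hfirst := hgconv.add_inner_le_of_hasGradientAt (hg y) x
  have hprox := hstep.le_add_inner hconv hγ0 hε x
  have hLγ : L / 2 * ‖z - y‖ ^ 2 ≤ 1 / (2 * γ) * ‖z - y‖ ^ 2 := by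
    have : L ≤ 1 / γ := (le_div_comm₀ hγ0 hL).1 hγL
    have : 1 / (2 * γ) = 1 / γ / 2 := by ring
    exact mul_le_mul_of_nonneg_right (by linarith) (sq_nonneg _)
  have hinner : 1 / γ * ⟪x - z, z - (y - γ • g' y)⟫ =
      ⟪g' y, x - y⟫ - ⟪g' y, z - y⟫ - 1 / γ * ⟪z - y, y - x⟫ - 1 / γ * ‖z - y‖ ^ 2 := by
    rw [show z - (y - γ • g' y) = (z - y) + γ • g' y by module,
      show x - z = (x - y) - (z - y) by module, show y - x = -(x - y) by module]
    generalize x - y = a, z - y = b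
    rw [inner_add_right, real_inner_smul_right, inner_sub_left, inner_sub_left, inner_neg_right,
      real_inner_self_eq_norm_sq, real_inner_comm a b, real_inner_comm a (g' y),
      real_inner_comm b (g' y)]
    field_simp
    ring
  have hhalf : 1 / γ * ‖z - y‖ ^ 2 = 2 * (1 / (2 * γ) * ‖z - y‖ ^ 2) := by ring
  linarith
end
end
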